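/- For every real X > 0 and every natural number k ≥ 1, the oscillatory integral I_k(X) = ∫_0^X (X² - u²)^((k-2)/2) · u · sin(2πu) du satisfies |I_k(X)| ≤ C_k · X^(k/2) for a constant C_k depending only on k. -/

import Mathlib

open Real intervalIntegral

lemma osc_integrable (p X : ℝ) (hp : -1 < p) (hX : 0 < X) :
    IntervalIntegrable (fun u : ℝ => (X^2 - u^2) ^ p) MeasureTheory.volume 0 X := by
  have h1 : IntervalIntegrable (fun u : ℝ => (X - u) ^ p) MeasureTheory.volume 0 X := by
    have := (intervalIntegral.intervalIntegrable_rpow' (a := X) (b := 0) hp).comp_sub_left X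
    simpa using this
  have h2 : ContinuousOn (fun u : ℝ => (X + u) ^ p) (Set.uIcc 0 X) := by
    rw [Set.uIcc_of_le hX.le]
    apply ContinuousOn.rpow_const (by fun_prop)
    intro u hu
    left
    have := hu.1
    positivity
  refine (h1.mul_continuousOn h2).congr ?_
  intro u hu
  rw [Set.uIoc_of_le hX.le] at hu
  have e : X^2 - u^2 = (X - u) * (X + u) := by ring
  simp only [e]
  rw [Real.mul_rpow (by linarith [hu.2]) (by linarith [hu.1])]

lemma osc_ftc (p X : ℝ) (hp : -1 < p) (hX : 0 < X) (h h' : ℝ → ℝ)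
    (hd : ∀ u, HasDerivAt h (h' u) u) (hc : Continuous h') :
    2 * (p + 1) * ∫ u in (0:ℝ)..X, (X^2 - u^2) ^ p * (u * h u)
      = (∫ u in (0:ℝ)..X, (X^2 - u^2) ^ (p + 1) * h' u) + (X^2) ^ (p + 1) * h 0 := by
  have hch : Continuous h := continuous_iff_continuousAt.2 fun u => (hd u).continuousAt
  have i1 : IntervalIntegrable (fun u : ℝ => (X^2 - u^2) ^ p * (u * h u))
      MeasureTheory.volume 0 X :=
    (osc_integrable p X hp hX).mul_continuousOn (by fun_prop)
  have i2 : IntervalIntegrable (fun u : ℝ => (X^2 - u^2) ^ (p + 1) * h' u)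
      MeasureTheory.volume 0 X :=
    (osc_integrable (p + 1) X (by linarith) hX).mul_continuousOn (by fun_prop)
  have key : ∫ u in (0:ℝ)..X, ((X^2 - u^2) ^ (p + 1) * h' u
        - 2 * (p + 1) * ((X^2 - u^2) ^ p * (u * h u)))
      = (X^2 - X^2) ^ (p + 1) * h X - (X^2 - 0^2) ^ (p + 1) * h 0 := by
    refine intervalIntegral.integral_eq_sub_of_hasDeriv_right
      (f := fun u => (X^2 - u^2) ^ (p + 1) * h u) ?_ ?_ (i2.sub (i1.const_mul _))
    · apply ContinuousOn.mul _ hch.continuousOn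
      apply ContinuousOn.rpow_const (by fun_prop)
      intro u hu
      right
      linarith
    · intro u hu
      rw [min_eq_left hX.le, max_eq_right hX.le] at hu
      have hw : 0 < X^2 - u^2 := by nlinarith [hu.1, hu.2]
      have d1 : HasDerivAt (fun u : ℝ => X^2 - u^2) (-(2 * u)) u := by
        simpa using ((hasDerivAt_id u).pow 2).const_sub (X^2)
      have d2 := (d1.rpow_const (p := p + 1) (Or.inl hw.ne')).mul (hd u)
      refine (d2.congr_deriv ?_).hasDerivWithinAt
      rw [add_sub_cancel_right]
      ring
  rw [intervalIntegral.integral_sub i2 (i1.const_mul _), intervalIntegral.integral_const_mul,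
    sub_self, Real.zero_rpow (by linarith)] at key
  simp only [ne_eq, OfNat.ofNat_ne_zero, not_false_eq_true, zero_pow, sub_zero] at key
  linarith

/-- cosine integral -/
noncomputable def oscA (p X : ℝ) : ℝ := ∫ u in (0:ℝ)..X, (X^2 - u^2) ^ p * cos (2 * π * u)
/-- sine integral -/
noncomputable def oscI (p X : ℝ) : ℝ := ∫ u in (0:ℝ)..X, (X^2 - u^2) ^ p * (u * sin (2 * π * u))

lemma osc_dsin (u : ℝ) : HasDerivAt (fun u => sin (2 * π * u)) (2 * π * cos (2 * π * u)) u := by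
  have := ((hasDerivAt_id u).const_mul (2 * π)).sin
  simpa [mul_comm, mul_left_comm] using this

lemma osc_dcos (u : ℝ) : HasDerivAt (fun u => cos (2 * π * u)) (-(2 * π * sin (2 * π * u))) u := by
  have := ((hasDerivAt_id u).const_mul (2 * π)).cos
  simpa [mul_comm, mul_left_comm] using this

lemma osc_rec1 (p X : ℝ) (hp : -1 < p) (hX : 0 < X) :
    (p + 1) * oscI p X = π * oscA (p + 1) X := by
  have := osc_ftc p X hp hX _ _ osc_dsin (by fun_prop)
  have e : ∫ u in (0:ℝ)..X, (X^2 - u^2) ^ (p + 1) * (2 * π * cos (2 * π * u))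
      = 2 * π * oscA (p + 1) X := by
    rw [oscA, ← intervalIntegral.integral_const_mul]
    congr 1; ext u; ring
  rw [e] at this
  simp only [mul_zero, sin_zero, add_zero] at this
  rw [oscI]
  linarith

lemma osc_rec2 (p X : ℝ) (hp : -1 < p) (hX : 0 < X) :
    2 * (p + 1) * (X^2 * oscA p X - oscA (p + 1) X) = oscA (p + 1) X - 2 * π * oscI (p + 1) X := by
  have := osc_ftc p X hp hX (fun u => u * cos (2 * π * u)) _
    (fun u => (hasDerivAt_id u).mul (osc_dcos u)) (by simp only [id]; fun_prop)
  have j0 : IntervalIntegrable (fun u : ℝ => (X^2 - u^2) ^ p * cos (2 * π * u))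
      MeasureTheory.volume 0 X :=
    (osc_integrable p X hp hX).mul_continuousOn (by fun_prop)
  have j1 : IntervalIntegrable (fun u : ℝ => (X^2 - u^2) ^ (p+1) * cos (2 * π * u))
      MeasureTheory.volume 0 X :=
    (osc_integrable (p+1) X (by linarith) hX).mul_continuousOn (by fun_prop)
  have j2 : IntervalIntegrable (fun u : ℝ => (X^2 - u^2) ^ (p+1) * (u * sin (2 * π * u)))
      MeasureTheory.volume 0 X :=
    (osc_integrable (p+1) X (by linarith) hX).mul_continuousOn (by fun_prop)
  have e1 : ∫ u in (0:ℝ)..X, (X^2 - u^2) ^ p * (u * (u * cos (2 * π * u)))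
      = X^2 * oscA p X - oscA (p + 1) X := by
    rw [oscA, oscA, ← intervalIntegral.integral_const_mul,
      ← intervalIntegral.integral_sub (j0.const_mul _) j1]
    apply intervalIntegral.integral_congr
    intro u hu
    rw [Set.uIcc_of_le hX.le] at hu
    have hw : 0 ≤ X^2 - u^2 := by nlinarith [hu.1, hu.2]
    have : (X^2 - u^2) ^ (p + 1) = (X^2 - u^2) ^ p * (X^2 - u^2) := by
      rw [Real.rpow_add' hw (by linarith), Real.rpow_one]
    simp only [this]
    ring
  have e2 : ∫ u in (0:ℝ)..X, (X^2 - u^2) ^ (p + 1) *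
        (1 * cos (2 * π * u) + id u * (-(2 * π * sin (2 * π * u))))
      = oscA (p + 1) X - 2 * π * oscI (p + 1) X := by
    rw [oscA, oscI, ← intervalIntegral.integral_const_mul,
      ← intervalIntegral.integral_sub j1 (j2.const_mul _)]
    congr 1; ext u; simp only [id]; ring
  rw [e1, e2] at this
  simpa using this

/-- first derivative test for the part away from the endpoint -/
lemma osc_far (b : ℝ) (hb : 0 ≤ b) (g g' s t : ℝ → ℝ) 
    (hg : ∀ u ∈ Set.Icc 0 b, HasDerivAt g (g' u) u)
    (hgc : ContinuousOn g' (Set.Icc 0 b)) (h0 : 0 ≤ g 0)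
    (hg' : ∀ u ∈ Set.Icc 0 b, 0 ≤ g' u)
    (hs : ∀ u, HasDerivAt s (t u) u) (ht : Continuous t) (hs1 : ∀ u, |s u| ≤ 1) :
    |∫ u in (0:ℝ)..b, g u * t u| ≤ 2 * g b := by
  have hsc : Continuous s := continuous_iff_continuousAt.2 fun u => (hs u).continuousAt
  rw [← Set.uIcc_of_le hb] at hg hgc
  have hi := hgc.intervalIntegrable (μ := MeasureTheory.volume)
  have h1 := intervalIntegral.integral_mul_deriv_eq_deriv_mul (u := g) (v := s) (a := 0) (b := b)
    hg (fun u _ => hs u) hi (ht.intervalIntegrable _ _)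
  have h2 := intervalIntegral.integral_eq_sub_of_hasDerivAt hg hi
  have h4 : 0 ≤ ∫ u in (0:ℝ)..b, g' u := intervalIntegral.integral_nonneg hb hg'
  have h3 : |∫ u in (0:ℝ)..b, g' u * s u| ≤ ∫ u in (0:ℝ)..b, g' u := by
    refine (intervalIntegral.abs_integral_le_integral_abs hb).trans ?_
    apply intervalIntegral.integral_mono_on hb (hi.mul_continuousOn hsc.continuousOn).abs hi
    intro u hu
    rw [abs_mul, abs_of_nonneg (hg' u hu)]
    exact mul_le_of_le_one_right (hg' u hu) (hs1 u)
  have hgb : 0 ≤ g b := by linarith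
  have k1 : |g b * s b| ≤ g b := by
    rw [abs_mul, abs_of_nonneg hgb]; exact mul_le_of_le_one_right hgb (hs1 b)
  have k2 : |g 0 * s 0| ≤ g 0 := by
    rw [abs_mul, abs_of_nonneg h0]; exact mul_le_of_le_one_right h0 (hs1 0)
  rw [h1]
  rw [abs_le] at *
  constructor <;> linarith [k1.1, k1.2, k2.1, k2.2, h3.1, h3.2]

/-- the part near the endpoint -/
lemma osc_near (p X M : ℝ) (hp : -1 < p) (hp0 : p ≤ 0) (hX : 1 ≤ X) (f : ℝ → ℝ) (hf : Continuous f)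
    (hM : ∀ u ∈ Set.Icc (X-1) X, |f u| ≤ M) :
    |∫ u in (X-1)..X, (X^2 - u^2) ^ p * f u| ≤ M * X ^ p / (p + 1) := by
  have hX0 : 0 < X := by linarith
  have hle : X - 1 ≤ X := by linarith
  have hsub : Set.uIcc (X-1) X ⊆ Set.uIcc 0 X := by
    rw [Set.uIcc_of_le hle, Set.uIcc_of_le hX0.le]
    exact Set.Icc_subset_Icc_left (by linarith)
  have i1 := (osc_integrable p X hp hX0).mono_set hsub
  have i2 : IntervalIntegrable (fun u : ℝ => (X - u) ^ p) MeasureTheory.volume (X-1) X := by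
    have := (intervalIntegral.intervalIntegrable_rpow' (a := 1) (b := 0) hp).comp_sub_left X
    simpa using this
  have e : ∫ u in (X-1)..X, M * X ^ p * (X - u) ^ p = M * X ^ p / (p + 1) := by
    rw [intervalIntegral.integral_const_mul,
      intervalIntegral.integral_comp_sub_left (fun u => u ^ p) X, integral_rpow (Or.inl hp)]
    simp only [sub_self, sub_sub_cancel, one_rpow]
    rw [Real.zero_rpow (by linarith)]
    ring
  rw [← e]
  refine (intervalIntegral.abs_integral_le_integral_abs hle).trans ?_
  apply intervalIntegral.integral_mono_on hle (i1.mul_continuousOn hf.continuousOn).abs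
    (i2.const_mul _)
  intro u hu
  have hu1 := hu.1
  have hu2 := hu.2
  have e : X^2 - u^2 = (X - u) * (X + u) := by ring
  rw [e, abs_mul, Real.mul_rpow (by linarith) (by linarith)]
  have a1 : 0 ≤ (X - u) ^ p := Real.rpow_nonneg (by linarith) _
  have a2 : 0 ≤ (X + u) ^ p := Real.rpow_nonneg (by linarith) _
  have a3 : (X + u) ^ p ≤ X ^ p := Real.rpow_le_rpow_of_nonpos hX0 (by linarith) hp0
  rw [abs_of_nonneg (mul_nonneg a1 a2)]
  have a4 := hM u hu
  calc (X - u) ^ p * (X + u) ^ p * |f u| ≤ (X - u) ^ p * X ^ p * M := by gcongr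
    _ = _ := by ring

lemma osc_two_pi : (1:ℝ) ≤ 2 * π := by linarith [Real.pi_gt_three]

lemma osc_base (p : ℝ) (hp : -1 < p) (hp0 : p ≤ 0) :
    ∃ C, ∀ X : ℝ, 1 ≤ X → |oscA p X| ≤ C * X ^ p ∧ |oscI p X| ≤ C * X ^ (p + 1) := by
  refine ⟨2 + 1 / (p + 1), fun X hX => ?_⟩
  have hX0 : 0 < X := by linarith
  have hb : 0 ≤ X - 1 := by linarith
  have hp1 : 0 < p + 1 := by linarith
  have i0 := osc_integrable p X hp hX0
  have s1 : Set.uIcc 0 (X-1) ⊆ Set.uIcc 0 X := by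
    rw [Set.uIcc_of_le hb, Set.uIcc_of_le hX0.le]
    exact Set.Icc_subset_Icc_right (by linarith)
  have s2 : Set.uIcc (X-1) X ⊆ Set.uIcc 0 X := by
    rw [Set.uIcc_of_le (by linarith), Set.uIcc_of_le hX0.le]
    exact Set.Icc_subset_Icc_left (by linarith)
  have split : ∀ f : ℝ → ℝ, Continuous f → ∫ u in (0:ℝ)..X, (X^2 - u^2) ^ p * f u
      = (∫ u in (0:ℝ)..(X-1), (X^2 - u^2) ^ p * f u) + ∫ u in (X-1)..X, (X^2 - u^2) ^ p * f u := by
    intro f hf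
    have i := i0.mul_continuousOn (hf.continuousOn (s := Set.uIcc 0 X))
    exact (intervalIntegral.integral_add_adjacent_intervals (i.mono_set s1) (i.mono_set s2)).symm
  have hw : ∀ u ∈ Set.Icc 0 (X-1), 0 < X^2 - u^2 := fun u hu => by nlinarith [hu.1, hu.2]
  have hwd : ∀ u ∈ Set.Icc 0 (X-1), HasDerivAt (fun u => (X^2 - u^2) ^ p)
      (-(2 * u) * p * (X^2 - u^2) ^ (p - 1)) u := by
    intro u hu
    have d1 : HasDerivAt (fun u : ℝ => X^2 - u^2) (-(2 * u)) u := by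
      simpa using ((hasDerivAt_id u).pow 2).const_sub (X^2)
    exact d1.rpow_const (Or.inl (hw u hu).ne')
  have hwc : ∀ q : ℝ, ContinuousOn (fun u => (X^2 - u^2) ^ q) (Set.Icc 0 (X-1)) := fun q =>
    ContinuousOn.rpow_const (by fun_prop) fun u hu => Or.inl (hw u hu).ne'
  have hwp : ∀ u ∈ Set.Icc 0 (X-1), 0 ≤ -(2 * u) * p * (X^2 - u^2) ^ (p - 1) := by
    intro u hu
    have := Real.rpow_nonneg (hw u hu).le (p - 1)
    refine mul_nonneg ?_ this
    nlinarith [hu.1]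
  have hwb : (X^2 - (X-1)^2) ^ p ≤ X ^ p :=
    Real.rpow_le_rpow_of_nonpos hX0 (by nlinarith) hp0
  have hXp : 0 < X ^ p := Real.rpow_pos_of_pos hX0 p
  have hπ := osc_two_pi
  have hπ0 : (2 * π) ≠ 0 := by linarith
  have habs : ∀ y : ℝ, |y| ≤ 1 → |y / (2 * π)| ≤ 1 := by
    intro y hy
    rw [abs_div, abs_of_pos (by linarith : 0 < 2 * π), div_le_one (by linarith)]
    linarith
  constructor
  · have far := osc_far (X-1) hb (fun u => (X^2 - u^2) ^ p) _ (fun u => sin (2 * π * u) / (2 * π))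
      (fun u => cos (2 * π * u)) hwd
      (((by fun_prop : Continuous fun u : ℝ => -(2 * u) * p).continuousOn).mul (hwc _))
      (Real.rpow_nonneg (by simp; positivity) _) hwp
      (fun u => ((osc_dsin u).div_const (2 * π)).congr_deriv (by field_simp)) (by fun_prop)
      (fun u => habs _ (abs_sin_le_one _))
    have near := osc_near p X 1 hp hp0 hX (fun u => cos (2 * π * u)) (by fun_prop)
      (fun u _ => abs_cos_le_one _)
    rw [oscA, split _ (by fun_prop)]
    refine (abs_add_le _ _).trans ((add_le_add far near).trans ?_)
    calc _ ≤ 2 * X ^ p + 1 * X ^ p / (p + 1) := by gcongr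
      _ = _ := by ring
  · have far := osc_far (X-1) hb (fun u => (X^2 - u^2) ^ p * u)
      _ (fun u => -cos (2 * π * u) / (2 * π))
      (fun u => sin (2 * π * u)) (fun u hu => (hwd u hu).mul (hasDerivAt_id u))
      (((((by fun_prop : Continuous fun u : ℝ => -(2 * u) * p).continuousOn).mul (hwc _)).mul
        continuousOn_id).add ((hwc p).mul continuousOn_const))
      (by simp) 
      (fun u hu => add_nonneg (mul_nonneg (hwp u hu) hu.1)
        (mul_nonneg (Real.rpow_nonneg (hw u hu).le _) zero_le_one))
      (fun u => ((osc_dcos u).neg.div_const (2 * π)).congr_deriv (by field_simp)) (by fun_prop)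
      (fun u => habs _ (by rw [abs_neg]; exact abs_cos_le_one _))
    have near := osc_near p X X hp hp0 hX (fun u => u * sin (2 * π * u)) (by fun_prop)
      (fun u hu => by
        rw [abs_mul, abs_of_nonneg (by linarith [hu.1] : 0 ≤ u)]
        have := abs_sin_le_one (2 * π * u)
        nlinarith [hu.1, hu.2, abs_nonneg (sin (2 * π * u))])
    rw [oscI, split _ (by fun_prop)]
    simp only [mul_assoc] at far near ⊢
    refine (abs_add_le _ _).trans ((add_le_add far near).trans ?_)
    have eX : X ^ (p + 1) = X ^ p * X := by rw [Real.rpow_add hX0, Real.rpow_one]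
    rw [eX]
    calc _ ≤ 2 * (X ^ p * X) + X * X ^ p / (p + 1) := by
          gcongr
          linarith
      _ = _ := by ring

lemma osc_step (p : ℝ) (hp : -1 < p)
    (h : ∃ C, ∀ X : ℝ, 1 ≤ X → |oscA p X| ≤ C * X ^ p ∧ |oscI p X| ≤ C * X ^ (p + 1)) :
    ∃ C, ∀ X : ℝ, 1 ≤ X → |oscA (p+1) X| ≤ C * X ^ (p+1) ∧ |oscI (p+1) X| ≤ C * X ^ (p + 1 + 1) := by
  obtain ⟨C, h⟩ := h
  have hp1 : 0 < p + 1 := by linarith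
  have hC : 0 ≤ C := by
    have := (h 1 le_rfl).1
    simp only [one_rpow, mul_one] at this
    exact (abs_nonneg _).trans this
  refine ⟨(p + 1) * C + (2 * p + 3) * ((p+1) * C) + 2 * (p + 1) * C, fun X hX => ?_⟩
  have hX0 : 0 < X := by linarith
  obtain ⟨hA, hI⟩ := h X hX
  have r1 := osc_rec1 p X hp hX0
  have r2 := osc_rec2 p X hp hX0
  have hπ := Real.pi_gt_three
  have e1 : X ^ (p + 1) = X ^ p * X := by rw [Real.rpow_add hX0, Real.rpow_one]
  have e2 : X ^ (p + 1 + 1) = X ^ p * X^2 := by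
    rw [Real.rpow_add hX0, Real.rpow_one, e1]; ring
  have hXp : 0 < X ^ p := Real.rpow_pos_of_pos hX0 p
  have bA : |oscA (p+1) X| ≤ (p + 1) * C * X ^ (p + 1) := by
    have : π * |oscA (p+1) X| = (p + 1) * |oscI p X| := by
      rw [← abs_of_pos Real.pi_pos, ← abs_mul, ← r1, abs_mul,
        abs_of_pos hp1]
    have h2 := mul_le_mul_of_nonneg_left hI hp1.le
    nlinarith [abs_nonneg (oscA (p+1) X)]
  have bI : |oscI (p+1) X| ≤ (2 * p + 3) * |oscA (p+1) X| + 2 * (p + 1) * (X^2 * |oscA p X|) := by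
    have h1 : 2 * π * oscI (p + 1) X = (2 * p + 3) * oscA (p+1) X - 2 * (p + 1) * (X^2 * oscA p X) := by
      linarith
    have h2 : 2 * π * |oscI (p+1) X| ≤ (2 * p + 3) * |oscA (p+1) X|
        + 2 * (p + 1) * (X^2 * |oscA p X|) := by
      have := abs_sub ((2 * p + 3) * oscA (p+1) X) (2 * (p + 1) * (X^2 * oscA p X))
      rw [← h1] at this
      simp only [abs_mul, abs_two, abs_of_pos Real.pi_pos, abs_of_pos hp1,
        abs_of_pos (by linarith : 0 < 2 * p + 3), abs_of_pos (by positivity : 0 < X^2)] at this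
      exact this
    nlinarith [abs_nonneg (oscI (p+1) X)]
  have q1 : 0 ≤ (2 * p + 3) * ((p+1) * C) := by
    have : 0 < 2 * p + 3 := by linarith
    positivity
  have q2 : 0 ≤ 2 * (p+1) * C := by positivity
  have q3 : 0 ≤ (p+1) * C := by positivity
  have z1 : 0 ≤ X ^ (p + 1) := by positivity
  have z2 : X ^ (p + 1) ≤ X ^ (p + 1 + 1) := Real.rpow_le_rpow_of_exponent_le hX (by linarith)
  constructor
  · nlinarith
  · have t1 : (2 * p + 3) * |oscA (p+1) X| ≤ (2 * p + 3) * ((p + 1) * C) * X ^ (p + 1 + 1) := by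
      calc (2 * p + 3) * |oscA (p+1) X| ≤ (2 * p + 3) * ((p + 1) * C * X ^ (p + 1)) :=
            mul_le_mul_of_nonneg_left bA (by linarith)
        _ = (2 * p + 3) * ((p + 1) * C) * X ^ (p + 1) := by ring
        _ ≤ _ := mul_le_mul_of_nonneg_left z2 q1
    have t2 : 2 * (p + 1) * (X^2 * |oscA p X|) ≤ 2 * (p + 1) * C * X ^ (p + 1 + 1) := by
      calc 2 * (p + 1) * (X^2 * |oscA p X|) ≤ 2 * (p + 1) * (X^2 * (C * X ^ p)) := by gcongr
        _ = _ := by rw [e2]; ring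
    have t3 : 0 ≤ (p + 1) * C * X ^ (p + 1 + 1) := mul_nonneg q3 (z1.trans z2)
    linarith

lemma osc_all (k : ℕ) : ∃ C, ∀ X : ℝ, 1 ≤ X →
    |oscA (((k:ℝ) - 1) / 2) X| ≤ C * X ^ (((k:ℝ) - 1) / 2) ∧
    |oscI (((k:ℝ) - 1) / 2) X| ≤ C * X ^ (((k:ℝ) - 1) / 2 + 1) := by
  induction k using Nat.twoStepInduction with
  | zero => exact osc_base _ (by norm_num) (by norm_num)
  | one => exact osc_base _ (by norm_num) (by norm_num)
  | more n ih _ =>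
    have e : (((n + 2 : ℕ) : ℝ) - 1) / 2 = ((n:ℝ) - 1) / 2 + 1 := by push_cast; ring
    rw [e]
    refine osc_step _ ?_ ih
    have : (0:ℝ) ≤ n := Nat.cast_nonneg n
    linarith

lemma osc_small (p X : ℝ) (hp : -1 < p) (hX : 0 < X) (hX1 : X ≤ 1) :
    |oscI p X| ≤ 1 / (2 * (p + 1)) * X ^ (p + 1) := by
  have hp1 : 0 < p + 1 := by linarith
  have h := osc_ftc p X hp hX (fun _ => 1) (fun _ => 0) (fun u => hasDerivAt_const u 1) (by fun_prop)
  simp only [mul_one, mul_zero, intervalIntegral.integral_zero, zero_add] at h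
  have i0 := osc_integrable p X hp hX
  have h1 : |oscI p X| ≤ ∫ u in (0:ℝ)..X, (X^2 - u^2) ^ p * u := by
    refine (intervalIntegral.abs_integral_le_integral_abs hX.le).trans ?_
    apply intervalIntegral.integral_mono_on hX.le (i0.mul_continuousOn (by fun_prop)).abs
      (i0.mul_continuousOn (by fun_prop))
    intro u hu
    have hw : 0 ≤ X^2 - u^2 := by nlinarith [hu.1, hu.2]
    rw [abs_mul, abs_mul, abs_of_nonneg (Real.rpow_nonneg hw p), abs_of_nonneg hu.1]
    have := mul_le_of_le_one_right hu.1 (abs_sin_le_one (2 * π * u))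
    have := Real.rpow_nonneg hw p
    gcongr
  have h2 : (X^2) ^ (p + 1) ≤ X ^ (p + 1) :=
    Real.rpow_le_rpow (by positivity) (by nlinarith) hp1.le
  refine h1.trans ?_
  rw [div_mul_eq_mul_div, le_div_iff₀ (by positivity)]
  linarith

theorem oscillatory_integral_bound :
    ∀ k : ℕ, 1 ≤ k → ∃ C : ℝ, ∀ X : ℝ, 0 < X →
      |∫ u in (0:ℝ)..X, (X^2 - u^2) ^ (((k:ℝ) - 2)/2) * u * Real.sin (2 * Real.pi * u)|
        ≤ C * X ^ ((k:ℝ)/2) := by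
  intro k hk
  obtain ⟨m, rfl⟩ : ∃ m, k = m + 1 := ⟨k - 1, by omega⟩
  obtain ⟨C, hC⟩ := osc_all m
  have e1 : (((m + 1 : ℕ) : ℝ) - 2) / 2 = ((m:ℝ) - 1) / 2 := by push_cast; ring
  have e2 : ((m + 1 : ℕ) : ℝ) / 2 = ((m:ℝ) - 1) / 2 + 1 := by push_cast; ring
  have hm : (0:ℝ) ≤ m := Nat.cast_nonneg m
  rw [e1, e2]
  refine ⟨max C (1 / (2 * (((m:ℝ) - 1) / 2 + 1))), fun X hX => ?_⟩
  have hXp : 0 ≤ X ^ (((m:ℝ) - 1) / 2 + 1) := by positivity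
  have key : |oscI (((m:ℝ) - 1) / 2) X| ≤ max C (1 / (2 * (((m:ℝ) - 1) / 2 + 1)))
      * X ^ (((m:ℝ) - 1) / 2 + 1) := by
    rcases le_total 1 X with h | h
    · exact ((hC X h).2).trans (mul_le_mul_of_nonneg_right (le_max_left _ _) hXp)
    · exact (osc_small _ X (by linarith) hX h).trans
        (mul_le_mul_of_nonneg_right (le_max_right _ _) hXp)
  simpa only [oscI, mul_assoc] using key
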